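/- arXiv:1109.0385 — 8 statements merged into one kernel-verified Lean document; each statement's English description precedes it below -/
import Mathlib

section
/- Let 0 < Φ < π/2 and let f : ℝ² → ℂ be a Schwartz function whose Fourier transform f̂ vanishes at every point of the wedge W_Φ (i.e. f̂(ξ) = 0 for all ξ ∈ W_Φ). Then for every ω ∈ [−Φ, Φ] and every s ∈ ℝ, the Radon transform of f vanishes: ∫_ℝ f(s θ(ω) + t θ(ω)^⊥) dt = 0. (This is the content of the paper's Theorem on the kernel of the limited angle Radon transform: any function whose Fourier support avoids the visibility wedge lies in the kernel of the limited angle Radon transform R_Φ.) -/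
open MeasureTheory Real

/-- The two-dimensional Fourier transform `f̂(ξ) = (2π)⁻¹ ∫ f(x) e^{-i x·ξ} dx`. -/
noncomputable def fourier2 (f : ℝ × ℝ → ℂ) (ξ : ℝ × ℝ) : ℂ :=
  (2 * π : ℝ)⁻¹ * ∫ x : ℝ × ℝ, f x * Complex.exp (-Complex.I * (x.1 * ξ.1 + x.2 * ξ.2))

/-- The polar wedge `W_Φ = {r (cos ω, sin ω) : r ∈ ℝ, |ω| ≤ Φ}`. -/
def wedge (Φ : ℝ) : Set (ℝ × ℝ) :=
  {ξ | ∃ r ω : ℝ, |ω| ≤ Φ ∧ ξ = (r * Real.cos ω, r * Real.sin ω)}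

lemma radon_aux_zero (g : SchwartzMap (ℝ × ℝ) ℂ)
    (h : ∀ r : ℝ, ∫ x : ℝ × ℝ, g x * Complex.exp (-Complex.I * (r * x.1)) = 0) (s : ℝ) :
    ∫ t : ℝ, g (s, t) = 0 := by
  have hgi : Integrable (fun x : ℝ × ℝ => g x) (volume.prod volume) := g.integrable (μ := volume)
  set G : ℝ → ℂ := fun s => ∫ t : ℝ, g (s, t) with hG
  have hGi : Integrable G := hgi.integral_prod_left
  obtain ⟨C0, hC0⟩ := g.decay 0 0
  obtain ⟨C2, hC2⟩ := g.decay 2 0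
  have hbound : ∀ s t : ℝ, ‖g (s, t)‖ ≤ (C0 + C2) * (1 + t ^ 2)⁻¹ := by
    intro s t
    have h0 := hC0.2 (s, t)
    have h2 := hC2.2 (s, t)
    simp only [pow_zero, one_mul, norm_iteratedFDeriv_zero] at h0 h2
    have ht : t ^ 2 ≤ ‖((s, t) : ℝ × ℝ)‖ ^ 2 := by
      rw [← sq_abs t]
      exact pow_le_pow_left₀ (abs_nonneg t) (norm_snd_le ((s, t) : ℝ × ℝ)) 2
    rw [← div_eq_mul_inv, le_div_iff₀ (by positivity)]
    nlinarith [mul_le_mul_of_nonneg_right ht (norm_nonneg (g (s, t)))]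
  have hGc : Continuous G := by
    refine continuous_of_dominated (bound := fun t => (C0 + C2) * (1 + t ^ 2)⁻¹) ?_ ?_ ?_ ?_
    · intro s
      exact (g.continuous.comp (by fun_prop : Continuous fun t : ℝ => (s, t))).aestronglyMeasurable
    · intro s
      exact Filter.Eventually.of_forall (hbound s)
    · exact integrable_inv_one_add_sq.const_mul _
    · exact Filter.Eventually.of_forall fun t =>
        g.continuous.comp (by fun_prop : Continuous fun s : ℝ => (s, t))
  have hF : FourierTransform.fourier G = (fun _ => (0 : ℂ)) := by
    funext v
    rw [Real.fourier_real_eq_integral_exp_smul]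
    have h1 := h (2 * π * v)
    have hint : Integrable (fun x : ℝ × ℝ =>
        g x * Complex.exp (-Complex.I * (((2 * π * v : ℝ) : ℂ) * x.1))) (volume.prod volume) := by
      refine hgi.mono ?_ ?_
      · exact (g.continuous.mul (by fun_prop)).aestronglyMeasurable
      · refine Filter.Eventually.of_forall fun x => ?_
        rw [norm_mul, Complex.norm_exp]
        simp
    rw [Measure.volume_eq_prod, integral_prod _ hint] at h1
    rw [← h1]
    congr 1
    funext x
    simp only [hG]
    rw [integral_mul_const, smul_eq_mul, mul_comm]
    congr 2
    push_cast
    ring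
  have hinv := hGc.fourierInv_fourier_eq hGi (by rw [hF]; exact integrable_zero _ _ _)
  have : G s = 0 := by
    rw [← hinv, hF, Real.fourierInv_eq]
    simp
  exact this

/-- If a Schwartz function has Fourier transform vanishing on the visibility wedge `W_Φ`,
then its limited angle Radon transform vanishes identically. -/
theorem kernel_of_limited_angle_radon
    (Φ : ℝ) (hΦ0 : 0 < Φ) (hΦ : Φ < π / 2)
    (f : SchwartzMap (ℝ × ℝ) ℂ)
    (hker : ∀ ξ ∈ wedge Φ, fourier2 (⇑f) ξ = 0)
    (ω : ℝ) (hω : ω ∈ Set.Icc (-Φ) Φ) (s : ℝ) :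
    ∫ t : ℝ, f (s * Real.cos ω - t * Real.sin ω, s * Real.sin ω + t * Real.cos ω) = 0 := by
  let R : ℂ ≃ₗᵢ[ℝ] ℂ := rotation (Circle.exp ω)
  let L : (ℝ × ℝ) ≃L[ℝ] (ℝ × ℝ) :=
    (Complex.equivRealProdCLM.symm.trans R.toContinuousLinearEquiv).trans Complex.equivRealProdCLM
  have hL : ∀ x : ℝ × ℝ, L x = (x.1 * Real.cos ω - x.2 * Real.sin ω,
      x.1 * Real.sin ω + x.2 * Real.cos ω) := by
    intro x
    have : L x = ((Complex.exp (ω * Complex.I) * ⟨x.1, x.2⟩ : ℂ).re,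
      (Complex.exp (ω * Complex.I) * ⟨x.1, x.2⟩ : ℂ).im) := rfl
    rw [this, Complex.mul_re, Complex.mul_im, Complex.exp_ofReal_mul_I_re,
      Complex.exp_ofReal_mul_I_im]
    ext <;> simp <;> ring
  have hmp : MeasurePreserving L volume volume :=
    (Complex.volume_preserving_equiv_real_prod.comp R.measurePreserving).comp
      Complex.volume_preserving_equiv_real_prod.symm
  let g : SchwartzMap (ℝ × ℝ) ℂ := SchwartzMap.compCLMOfContinuousLinearEquiv ℝ L f
  have hg : ∀ x, g x = f (L x) := fun x => rfl
  have key := radon_aux_zero g ?_ s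
  · simpa only [hg, hL] using key
  · intro r
    have h1 := hker (r * Real.cos ω, r * Real.sin ω) ⟨r, ω, abs_le.2 hω, rfl⟩
    unfold fourier2 at h1
    have h2 := (mul_eq_zero.1 h1).resolve_left (by
      have := Real.pi_ne_zero
      simp [this])
    rw [← hmp.integral_comp L.toHomeomorph.measurableEmbedding] at h2
    rw [← h2]
    congr 1
    funext x
    rw [hg, hL]
    congr 3
    have hc : (Complex.cos ω) ^ 2 + (Complex.sin ω) ^ 2 = 1 := by
      rw [add_comm]; exact Complex.sin_sq_add_cos_sq _
    push_cast
    linear_combination (-(r * x.1 : ℂ)) * hc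
end

section
/- Let j ∈ ℕ, α ∈ ℝ, b ∈ ℝ², and set a_j = 2^{⌈j/2⌉+1}/π. Let W, V : ℝ → ℝ be C^∞ functions with supp W ⊆ (1/2, 2) and supp V ⊆ (−1, 1). Let ψ₀ : ℝ² → ℂ be a Schwartz function whose Fourier transform satisfies ψ̂₀(r cos ω, r sin ω) = 2^{-3j/4} · W(2^{-j} r) · V(a_j ω) for all r > 0 and all ω ∈ (−π, π]. Define ψ(x) = ψ₀(R_{−α}(x − b)). Then for every ω ∈ ℝ with |ω + α| ≤ π/2 and every s ∈ ℝ, the Radon transform of ψ is given by the closed formula ∫_ℝ ψ(s θ(ω) + t θ(ω)^⊥) dt = 2^{j/4} · √(2π) · V(a_j (ω + α)) · Ŵ(2^j (b·θ(ω) − s)). (This is the paper's closed-form expression for the Radon transform of a curvelet.) -/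
open MeasureTheory Real

/-- The one-dimensional Fourier transform `Ŵ(u) = (2π)^{-1/2} ∫ W(r) e^{-i r u} dr`. -/
noncomputable def fourier1 (W : ℝ → ℝ) (u : ℝ) : ℂ :=
  (Real.sqrt (2 * π) : ℝ)⁻¹ * ∫ r : ℝ, (W r : ℂ) * Complex.exp (-Complex.I * r * u)

/-- The rotation `R_η` with rows `(cos η, sin η)` and `(-sin η, cos η)` applied to a vector. -/
noncomputable def rot (η : ℝ) (v : ℝ × ℝ) : ℝ × ℝ :=
  (Real.cos η * v.1 + Real.sin η * v.2, -Real.sin η * v.1 + Real.cos η * v.2)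


/-- Rotation by `φ` as a linear equivalence. -/
noncomputable def rotL (φ : ℝ) : (ℝ × ℝ) ≃ₗ[ℝ] (ℝ × ℝ) where
  toFun x := (x.1 * Real.cos φ - x.2 * Real.sin φ, x.1 * Real.sin φ + x.2 * Real.cos φ)
  invFun x := (x.1 * Real.cos φ + x.2 * Real.sin φ, - x.1 * Real.sin φ + x.2 * Real.cos φ)
  map_add' x y := by ext <;> simp <;> ring
  map_smul' c x := by ext <;> simp <;> ring
  left_inv x := by
    have h := Real.sin_sq_add_cos_sq φ
    ext
    · simp only; linear_combination x.1 * h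
    · simp only; linear_combination x.2 * h
  right_inv x := by
    have h := Real.sin_sq_add_cos_sq φ
    ext
    · simp only; linear_combination x.1 * h
    · simp only; linear_combination x.2 * h

lemma rotL_apply (φ : ℝ) (x : ℝ × ℝ) : rotL φ x =
    (x.1 * Real.cos φ - x.2 * Real.sin φ, x.1 * Real.sin φ + x.2 * Real.cos φ) := rfl

lemma rotL_det (φ : ℝ) : LinearMap.det (rotL φ : (ℝ × ℝ) →ₗ[ℝ] (ℝ × ℝ)) = 1 := by
  have : (rotL φ : (ℝ × ℝ) →ₗ[ℝ] (ℝ × ℝ)) =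
      Matrix.toLin (Module.Basis.finTwoProd ℝ) (Module.Basis.finTwoProd ℝ)
        !![Real.cos φ, -Real.sin φ; Real.sin φ, Real.cos φ] := by
    rw [Matrix.toLin_finTwoProd]
    ext <;> simp [rotL_apply]
  rw [this, LinearMap.det_toLin, Matrix.det_fin_two_of]
  linear_combination Real.sin_sq_add_cos_sq φ

lemma rotL_integral (φ : ℝ) (f : ℝ × ℝ → ℂ) : ∫ x, f (rotL φ x) = ∫ x, f x := by
  have hmp : MeasurePreserving (rotL φ) (volume : Measure (ℝ × ℝ)) volume := by
    refine ⟨(rotL φ).toContinuousLinearEquiv.continuous.measurable, ?_⟩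
    have h := Measure.map_linearMap_addHaar_eq_smul_addHaar (volume : Measure (ℝ × ℝ))
      (f := (rotL φ : (ℝ × ℝ) →ₗ[ℝ] (ℝ × ℝ))) (by rw [rotL_det]; norm_num)
    rw [rotL_det] at h
    simpa using h
  exact hmp.integral_comp
    (rotL φ).toContinuousLinearEquiv.toHomeomorph.measurableEmbedding f

lemma schwartz_slice (F : SchwartzMap (ℝ × ℝ) ℂ) :
    Continuous (fun p : ℝ => ∫ t : ℝ, F (p, t)) := by
  obtain ⟨C0, hC0, h0⟩ := F.decay 0 0
  obtain ⟨C2, hC2, h2⟩ := F.decay 2 0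
  refine continuous_of_dominated (bound := fun t => (C0 + C2) * (1 + t ^ 2)⁻¹) ?_ ?_ ?_ ?_
  · intro p
    exact (F.continuous.comp (by fun_prop)).aestronglyMeasurable
  · intro p
    refine Filter.Eventually.of_forall fun t => ?_
    have a0 := h0 (p, t)
    have a2 := h2 (p, t)
    simp only [norm_iteratedFDeriv_zero, pow_zero, one_mul] at a0 a2
    have hn : t ^ 2 ≤ ‖((p, t) : ℝ × ℝ)‖ ^ 2 := by
      rw [← sq_abs t]
      gcongr
      exact norm_snd_le ((p, t) : ℝ × ℝ)
    have : 0 < 1 + t ^ 2 := by positivity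
    rw [← div_eq_mul_inv, le_div_iff₀ this]
    nlinarith [mul_le_mul_of_nonneg_right hn (norm_nonneg (F (p, t)))]
  · exact integrable_inv_one_add_sq.const_mul _
  · refine Filter.Eventually.of_forall fun t => ?_
    exact F.continuous.comp (by fun_prop)

open FourierTransform in
lemma slice_fourier (ψ₀ : SchwartzMap (ℝ × ℝ) ℂ) (φ : ℝ) (w : ℝ) :
    𝓕 (fun p : ℝ => ∫ t : ℝ, ψ₀ (rotL φ (p, t))) w =
      (2 * π : ℝ) * fourier2 ψ₀ (2 * π * w * Real.cos φ, 2 * π * w * Real.sin φ) := by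
  have hπ : (π : ℂ) ≠ 0 := by exact_mod_cast Real.pi_ne_zero
  let F : SchwartzMap (ℝ × ℝ) ℂ :=
    SchwartzMap.compCLMOfContinuousLinearEquiv ℂ (rotL φ).toContinuousLinearEquiv ψ₀
  have hF : ∀ x, F x = ψ₀ (rotL φ x) := fun x => rfl
  rw [Real.fourier_real_eq_integral_exp_smul, fourier2, ← mul_assoc,
    ← Complex.ofReal_mul, mul_inv_cancel₀ (by positivity), Complex.ofReal_one, one_mul,
    ← rotL_integral φ]
  have hint : Integrable (fun x : ℝ × ℝ =>
      Complex.exp (((-2 * π * x.1 * w : ℝ) : ℂ) * Complex.I) * F x) (volume.prod volume) := by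
    refine (F.integrable (μ := volume)).bdd_mul (c := 1) ?_ ?_
    · exact Continuous.aestronglyMeasurable (by fun_prop)
    · refine Filter.Eventually.of_forall fun x => ?_
      rw [Complex.norm_exp_ofReal_mul_I]
  have := integral_prod _ hint
  rw [← Measure.volume_eq_prod] at this
  simp only [integral_const_mul] at this
  simp only [smul_eq_mul, ← hF]
  rw [← this]
  refine integral_congr_ae (Filter.Eventually.of_forall fun x => ?_)
  simp only
  rw [mul_comm]
  congr 2
  simp only [rotL_apply]
  have h : (Real.sin φ : ℂ) ^ 2 + (Real.cos φ : ℂ) ^ 2 = 1 := by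
    exact_mod_cast Real.sin_sq_add_cos_sq φ
  push_cast at h ⊢
  linear_combination (2 * π * w * x.1 * Complex.I) * h

/-- Closed formula for the Radon transform of a curvelet
`ψ(x) = ψ₀(R_{-α}(x - b))`, where, in polar coordinates,
`ψ̂₀(r cos ω, r sin ω) = 2^{-3j/4} W(2^{-j} r) V(a_j ω)`:
`R ψ(θ(ω), s) = 2^{j/4} √(2π) V(a_j (ω + α)) Ŵ(2^j (b·θ(ω) - s))`. -/
theorem radon_transform_of_curvelet
    (j : ℕ) (α : ℝ) (b : ℝ × ℝ)
    (W V : ℝ → ℝ) (hW : ContDiff ℝ (⊤ : ℕ∞) W) (hV : ContDiff ℝ (⊤ : ℕ∞) V)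
    (hWsupp : Function.support W ⊆ Set.Ioo (1/2 : ℝ) 2)
    (hVsupp : Function.support V ⊆ Set.Ioo (-1 : ℝ) 1)
    (aj : ℝ) (haj : aj = (2 : ℝ) ^ (⌈(j : ℝ) / 2⌉ + 1) / π)
    (ψ₀ : SchwartzMap (ℝ × ℝ) ℂ)
    (hψ₀ : ∀ r > (0 : ℝ), ∀ ω ∈ Set.Ioc (-π) π,
      fourier2 (⇑ψ₀) (r * Real.cos ω, r * Real.sin ω)
        = (((2 : ℝ) ^ (-(3 * (j : ℝ) / 4)) * W ((2 : ℝ) ^ (-(j : ℤ)) * r) * V (aj * ω) : ℝ) : ℂ))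
    (ψ : ℝ × ℝ → ℂ) (hψ : ∀ x, ψ x = ψ₀ (rot (-α) (x - b)))
    (ω : ℝ) (hω : |ω + α| ≤ π / 2) (s : ℝ) :
    ∫ t : ℝ, ψ (s * Real.cos ω - t * Real.sin ω, s * Real.sin ω + t * Real.cos ω)
      = (((2 : ℝ) ^ ((j : ℝ) / 4) * Real.sqrt (2 * π) * V (aj * (ω + α)) : ℝ) : ℂ)
        * fourier1 W ((2 : ℝ) ^ j * (b.1 * Real.cos ω + b.2 * Real.sin ω - s)) := by
  classical
  have hπ : (0 : ℝ) < π := Real.pi_pos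
  set φ := ω + α with hφ
  have hφ1 := (abs_le.mp hω).1
  have hφ2 := (abs_le.mp hω).2
  set B := b.1 * Real.cos ω + b.2 * Real.sin ω with hB
  let g : ℝ → ℂ := fun p => ∫ t : ℝ, ψ₀ (rotL φ (p, t))
  let F : SchwartzMap (ℝ × ℝ) ℂ :=
    SchwartzMap.compCLMOfContinuousLinearEquiv ℂ (rotL φ).toContinuousLinearEquiv ψ₀
  have hF : ∀ x, F x = ψ₀ (rotL φ x) := fun x => rfl
  -- reduce to the function `g`
  have hL : ∫ t : ℝ, ψ (s * Real.cos ω - t * Real.sin ω, s * Real.sin ω + t * Real.cos ω)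
      = g (s - B) := by
    have h1 : ∀ t : ℝ, ψ (s * Real.cos ω - t * Real.sin ω, s * Real.sin ω + t * Real.cos ω)
        = ψ₀ (rotL φ (s - B, t - (-b.1 * Real.sin ω + b.2 * Real.cos ω))) := by
      intro t
      rw [hψ]
      congr 1
      have h := Real.sin_sq_add_cos_sq ω
      simp only [rot, rotL_apply, hφ, hB, Real.cos_add, Real.sin_add, Real.cos_neg, Real.sin_neg,
        Prod.fst_sub, Prod.snd_sub]
      ext
      · simp only
        linear_combination (b.1 * Real.cos α - b.2 * Real.sin α) * h
      · simp only
        linear_combination (b.1 * Real.sin α + b.2 * Real.cos α) * h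
    simp only [h1]
    exact integral_sub_right_eq_self (fun t => ψ₀ (rotL φ (s - B, t))) _
  have hgc : Continuous g := schwartz_slice F
  have hgi : Integrable g := by
    have : Integrable (fun x => F x) ((volume : Measure ℝ).prod (volume : Measure ℝ)) :=
      F.integrable (μ := volume)
    exact this.integral_prod_left
  -- bound on the angular scaling
  have haj1 : 2 / π ≤ aj := by
    rw [haj]
    gcongr
    have h0 : (0 : ℤ) ≤ ⌈(j : ℝ) / 2⌉ := Int.ceil_nonneg (by positivity)
    calc (2 : ℝ) = 2 ^ (1 : ℤ) := by norm_num
      _ ≤ 2 ^ (⌈(j : ℝ) / 2⌉ + 1) := zpow_le_zpow_right₀ (by norm_num) (by omega)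
  have haj2 : 1 ≤ aj * (π / 2) := by
    calc (1 : ℝ) = 2 / π * (π / 2) := by field_simp
      _ ≤ _ := by gcongr
  have haj0 : 0 < aj := lt_of_lt_of_le (by positivity) haj1
  have hV0 : ∀ x, π / 2 ≤ |x| → V (aj * x) = 0 := by
    intro x hx
    by_contra hne
    have hm := hVsupp (Function.mem_support.mpr hne)
    have : |aj * x| < 1 := abs_lt.mpr hm
    rw [abs_mul, abs_of_pos haj0] at this
    nlinarith [mul_le_mul_of_nonneg_left hx haj0.le]
  have hW0 : ∀ x ≤ 0, W x = 0 := by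
    intro x hx
    by_contra hne
    have hm := hWsupp (Function.mem_support.mpr hne)
    have := hm.1
    linarith
  -- the Fourier transform of `g`
  let c : ℝ := 2 * π * ((2 : ℝ) ^ (-(3 * (j : ℝ) / 4)) * V (aj * φ))
  let k : ℝ := (2 : ℝ) ^ (-(j : ℤ)) * (2 * π)
  have hk : 0 < k := by positivity
  have hFg : ∀ w : ℝ, w ≠ 0 → FourierTransform.fourier g w = (c : ℂ) * (W (k * w) : ℂ) := by
    intro w hw
    rw [show FourierTransform.fourier g w = _ from slice_fourier ψ₀ φ w]
    rcases lt_or_gt_of_ne hw with hneg | hpos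
    · have hr : 0 < 2 * π * (-w) := by
        have : 0 < -w := by linarith
        positivity
      have hz : W (k * w) = 0 := hW0 _ (by nlinarith)
      rw [hz]
      suffices h : fourier2 ψ₀ (2 * π * w * Real.cos φ, 2 * π * w * Real.sin φ) = 0 by
        rw [h]; simp
      rcases le_or_gt φ 0 with h0 | h0
      · have := hψ₀ _ hr (φ + π) ⟨by linarith, by linarith⟩
        rw [Real.cos_add_pi, Real.sin_add_pi,
          hV0 (φ + π) (by rw [abs_of_nonneg (by linarith)]; linarith)] at this
        simpa using this
      · have := hψ₀ _ hr (φ - π) ⟨by linarith, by linarith⟩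
        rw [Real.cos_sub_pi, Real.sin_sub_pi,
          hV0 (φ - π) (by rw [abs_of_nonpos (by linarith)]; linarith)] at this
        simpa using this
    · rw [hψ₀ (2 * π * w) (by positivity) φ ⟨by linarith, by linarith⟩]
      simp only [c, k]
      rw [mul_assoc ((2 : ℝ) ^ (-(j : ℤ))) (2 * π) w]
      push_cast
      ring
  have hae : FourierTransform.fourier g =ᵐ[volume] fun w => (c : ℂ) * (W (k * w) : ℂ) := by
    have : ∀ᵐ w : ℝ, w ≠ 0 := by simp [ae_iff]
    filter_upwards [this] with w hw using hFg w hw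
  have hWi : Integrable (fun r => (W r : ℂ)) := by
    have hcs : HasCompactSupport W :=
      HasCompactSupport.of_support_subset_isCompact (isCompact_Icc (a := (1/2 : ℝ)) (b := 2))
        (hWsupp.trans Set.Ioo_subset_Icc_self)
    exact (hW.continuous.integrable_of_hasCompactSupport hcs).ofReal
  have hFi : Integrable (FourierTransform.fourier g) :=
    ((hWi.comp_mul_left' hk.ne').const_mul (c : ℂ)).congr hae.symm
  have hinv := congrFun (hgc.fourierInv_fourier_eq hgi hFi) (s - B)
  rw [hL, ← hinv, Real.fourierInv_eq']
  have e1 : ∫ v : ℝ, Complex.exp (((2 * π * inner ℝ v (s - B) : ℝ) : ℂ) * Complex.I) •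
      FourierTransform.fourier g v =
      ∫ v : ℝ, (fun r : ℝ => (c : ℂ) * ((W r : ℂ) *
        Complex.exp (-Complex.I * r * (((2 : ℝ) ^ j * (B - s) : ℝ) : ℂ)))) (k * v) := by
    refine integral_congr_ae ?_
    filter_upwards [hae] with v hv
    rw [hv, smul_eq_mul, mul_comm, mul_assoc]
    congr 3
    have h2 : ((2 : ℂ) ^ j) ≠ 0 := pow_ne_zero _ (by norm_num)
    simp only [k, zpow_neg, zpow_natCast]
    push_cast
    simp only [RCLike.inner_apply, conj_trivial]
    push_cast
    field_simp
    ring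
  rw [e1, Measure.integral_comp_mul_left (fun r : ℝ => (c : ℂ) * ((W r : ℂ) *
        Complex.exp (-Complex.I * r * (((2 : ℝ) ^ j * (B - s) : ℝ) : ℂ)))) k, integral_const_mul, fourier1, Complex.real_smul]
  rw [abs_of_pos (by positivity)]
  rw [← mul_assoc, ← mul_assoc]
  congr 1
  have hs : Real.sqrt (2 * π) ≠ 0 := by positivity
  rw [← Complex.ofReal_mul, ← Complex.ofReal_mul]
  congr 1
  have h3 : (2 : ℝ) ^ ((j : ℝ) / 4) = (2 : ℝ) ^ j * (2 : ℝ) ^ (-(3 * (j : ℝ) / 4)) := by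
    rw [← Real.rpow_natCast, ← Real.rpow_add (by norm_num)]
    congr 1
    ring
  rw [h3]
  simp only [c, k, zpow_neg, zpow_natCast]
  field_simp
end

section
/- Let j ∈ ℕ, α ∈ ℝ, b ∈ ℝ², and set a_j = 2^{⌈j/2⌉+1}/π. Let W, V : ℝ → ℝ be C^∞ functions with supp W ⊆ (1/2, 2) and supp V ⊆ (−1, 1). Let ψ₀ : ℝ² → ℂ be a Schwartz function whose Fourier transform satisfies ψ̂₀(r cos ω, r sin ω) = 2^{-3j/4} · W(2^{-j} r) · V(a_j ω) for all r > 0 and all ω ∈ (−π, π]. Define ψ(x) = ψ₀(R_{−α}(x − b)). Then for every ω ∈ ℝ with |ω + α| ≤ π/2 and a_j · |ω + α| ≥ 1, and every s ∈ ℝ, the Radon transform of ψ vanishes: ∫_ℝ ψ(s θ(ω) + t θ(ω)^⊥) dt = 0. (This expresses that a curvelet whose orientation lies outside the scale-dependent visible angular range is invisible, i.e. annihilated by the limited angle Radon transform.) -/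
open MeasureTheory Real

/-- The rotation `rot η` as a linear map. -/
noncomputable def rotLin (η : ℝ) : ℝ × ℝ →ₗ[ℝ] ℝ × ℝ :=
  Matrix.toLin (Module.Basis.finTwoProd ℝ) (Module.Basis.finTwoProd ℝ)
    !![Real.cos η, Real.sin η; -Real.sin η, Real.cos η]

lemma rotLin_apply (η : ℝ) (v : ℝ × ℝ) : rotLin η v = rot η v := by
  simp [rotLin, rot, Matrix.toLin_finTwoProd_apply]

lemma rot_continuous (η : ℝ) : Continuous (rot η) := by
  unfold rot; fun_prop

lemma rot_measurePreserving (η : ℝ) :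
    MeasurePreserving (rot η) (volume : Measure (ℝ × ℝ)) volume := by
  refine ⟨(rot_continuous η).measurable, ?_⟩
  have hdet : LinearMap.det (rotLin η) = 1 := by
    rw [rotLin, LinearMap.det_toLin, Matrix.det_fin_two_of]
    nlinarith [Real.sin_sq_add_cos_sq η]
  have h := Measure.map_linearMap_addHaar_eq_smul_addHaar (volume : Measure (ℝ × ℝ))
    (f := rotLin η) (by rw [hdet]; exact one_ne_zero)
  rw [hdet] at h
  have he : (⇑(rotLin η)) = rot η := funext (rotLin_apply η)
  rw [he] at h
  simpa using h

lemma slice_bound (f : SchwartzMap (ℝ × ℝ) ℂ) (η : ℝ) :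
    ∃ C : ℝ, ∀ s t : ℝ, ‖f (rot η (s, t))‖ ≤ C * (1 + t ^ 2)⁻¹ := by
  obtain ⟨C0, h0⟩ := f.decay' 0 0
  obtain ⟨C2, h2⟩ := f.decay' 2 0
  refine ⟨C0 + 4 * C2, fun s t => ?_⟩
  set x := rot η (s, t) with hx
  have h0 := h0 x
  have h2 := h2 x
  simp only [norm_iteratedFDeriv_zero, pow_zero, one_mul] at h0 h2
  change ‖f x‖ ≤ C0 at h0
  change ‖x‖ ^ 2 * ‖f x‖ ≤ C2 at h2
  have ht : t = Real.sin η * x.1 + Real.cos η * x.2 := by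
    simp only [hx, rot]
    linear_combination -t * (Real.sin_sq_add_cos_sq η)
  have h1 : |x.1| ≤ ‖x‖ := norm_fst_le x
  have h3 : |x.2| ≤ ‖x‖ := norm_snd_le x
  have hb : |t| ≤ 2 * ‖x‖ := by
    rw [ht]
    refine (abs_add_le _ _).trans ?_
    rw [abs_mul, abs_mul]
    have := mul_le_mul (Real.abs_sin_le_one η) h1 (abs_nonneg _) zero_le_one
    have := mul_le_mul (Real.abs_cos_le_one η) h3 (abs_nonneg _) zero_le_one
    linarith
  have ht2 : t ^ 2 ≤ 4 * ‖x‖ ^ 2 := by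
    rw [← sq_abs]; nlinarith [abs_nonneg t]
  rw [← div_eq_mul_inv, le_div_iff₀ (by positivity)]
  nlinarith [mul_le_mul_of_nonneg_right ht2 (norm_nonneg (f x))]

lemma slice_vanish (f : SchwartzMap (ℝ × ℝ) ℂ) (β : ℝ)
    (h : ∀ r : ℝ, r ≠ 0 → fourier2 f (r * Real.cos β, r * Real.sin β) = 0) (s : ℝ) :
    ∫ t : ℝ, f (rot (-β) (s, t)) = 0 := by
  set P : ℝ → ℂ := fun s => ∫ t : ℝ, f (rot (-β) (s, t)) with hP
  have hmp := rot_measurePreserving (-β)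
  have hFc : Continuous (fun p : ℝ × ℝ => f (rot (-β) p)) :=
    f.continuous.comp (rot_continuous _)
  have hFi : Integrable (fun p : ℝ × ℝ => f (rot (-β) p)) := by
    have hi : Integrable (fun x => f x) (volume : Measure (ℝ × ℝ)) := f.integrable
    exact hmp.integrable_comp_of_integrable hi
  have hPi : Integrable P := Integrable.integral_prod_left (f := fun p : ℝ × ℝ => f (rot (-β) p)) hFi
  have hPc : Continuous P := by
    obtain ⟨C, hC⟩ := slice_bound f (-β)
    refine continuous_of_dominated (bound := fun t => C * (1 + t ^ 2)⁻¹) ?_ ?_ ?_ ?_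
    · intro s
      exact (hFc.comp (by fun_prop : Continuous fun t : ℝ => (s, t))).aestronglyMeasurable
    · intro s
      exact Filter.Eventually.of_forall (hC s)
    · exact integrable_inv_one_add_sq.const_mul C
    · exact Filter.Eventually.of_forall fun t =>
        hFc.comp (by fun_prop : Continuous fun s : ℝ => (s, t))
  have key : ∀ w : ℝ, w ≠ 0 → FourierTransform.fourier P w = 0 := by
    intro w hw
    have h1 := h (2 * π * w) (by positivity)
    rw [fourier2, mul_eq_zero] at h1
    have h2 := h1.resolve_left (by
      have : (2 * π : ℝ)⁻¹ ≠ 0 := by positivity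
      exact_mod_cast this)
    rw [← hmp.map_eq, integral_map hmp.measurable.aemeasurable
      (by
        apply Continuous.aestronglyMeasurable
        have := f.continuous
        fun_prop)] at h2
    have h3 : ∀ p : ℝ × ℝ, f (rot (-β) p) * Complex.exp (-Complex.I *
        (((rot (-β) p).1 : ℂ) * ((2 * π * w * Real.cos β : ℝ) : ℂ)
          + ((rot (-β) p).2 : ℂ) * ((2 * π * w * Real.sin β : ℝ) : ℂ)))
        = Complex.exp (((-2 * π * p.1 * w : ℝ) : ℂ) * Complex.I) * f (rot (-β) p) := by
      intro p
      rw [mul_comm]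
      congr 2
      have : (rot (-β) p).1 * (2 * π * w * Real.cos β) + (rot (-β) p).2 * (2 * π * w * Real.sin β)
          = 2 * π * w * p.1 := by
        simp only [rot, Real.cos_neg, Real.sin_neg]
        linear_combination 2 * π * w * p.1 * (Real.sin_sq_add_cos_sq β)
      rw [← Complex.ofReal_mul, ← Complex.ofReal_mul, ← Complex.ofReal_add, this]
      push_cast
      ring
    simp only [h3] at h2
    rw [Real.fourier_real_eq_integral_exp_smul]
    rw [Measure.volume_eq_prod, integral_prod] at h2
    · rw [← h2]
      refine integral_congr_ae (Filter.Eventually.of_forall fun v => ?_)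
      simp only [hP, smul_eq_mul]
      rw [← integral_const_mul]
    · rw [← Measure.volume_eq_prod]
      refine hFi.bdd_mul (c := 1) ?_ ?_
      · apply Continuous.aestronglyMeasurable; fun_prop
      · exact Filter.Eventually.of_forall fun p => (Complex.norm_exp_ofReal_mul_I _).le
  have hae : FourierTransform.fourier P =ᵐ[volume] 0 := by
    have : ∀ᵐ w : ℝ, w ≠ 0 := by simp [ae_iff]
    filter_upwards [this] with w hw using key w hw
  have hinv := hPc.fourierInv_fourier_eq hPi ((integrable_zero _ _ _).congr hae.symm)
  have : P s = 0 := by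
    rw [← hinv, Real.fourierInv_eq']
    rw [integral_congr_ae (g := fun _ => 0)]
    · simp
    · filter_upwards [hae] with w hw
      simp [hw]
  exact this

/-- A curvelet whose orientation lies outside the scale-dependent visible angular
range is annihilated by the limited angle Radon transform: if `|ω + α| ≤ π/2` and
`a_j |ω + α| ≥ 1`, then the Radon transform of `ψ(x) = ψ₀(R_{-α}(x - b))` at angle
`θ(ω)` vanishes for every offset `s`. -/
theorem invisible_curvelet_radon_vanishes
    (j : ℕ) (α : ℝ) (b : ℝ × ℝ)
    (W V : ℝ → ℝ) (hW : ContDiff ℝ (⊤ : ℕ∞) W) (hV : ContDiff ℝ (⊤ : ℕ∞) V)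
    (hWsupp : Function.support W ⊆ Set.Ioo (1/2 : ℝ) 2)
    (hVsupp : Function.support V ⊆ Set.Ioo (-1 : ℝ) 1)
    (aj : ℝ) (haj : aj = (2 : ℝ) ^ (⌈(j : ℝ) / 2⌉ + 1) / π)
    (ψ₀ : SchwartzMap (ℝ × ℝ) ℂ)
    (hψ₀ : ∀ r > (0 : ℝ), ∀ ω ∈ Set.Ioc (-π) π,
      fourier2 (⇑ψ₀) (r * Real.cos ω, r * Real.sin ω)
        = (((2 : ℝ) ^ (-(3 * (j : ℝ) / 4)) * W ((2 : ℝ) ^ (-(j : ℤ)) * r) * V (aj * ω) : ℝ) : ℂ))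
    (ψ : ℝ × ℝ → ℂ) (hψ : ∀ x, ψ x = ψ₀ (rot (-α) (x - b)))
    (ω : ℝ) (hω : |ω + α| ≤ π / 2) (hinv : 1 ≤ aj * |ω + α|) (s : ℝ) :
    ∫ t : ℝ, ψ (s * Real.cos ω - t * Real.sin ω, s * Real.sin ω + t * Real.cos ω) = 0 := by
  set β := ω + α with hβ
  have hpi := Real.pi_pos
  have hajpos : 2 / π ≤ aj := by
    rw [haj]
    gcongr
    have h0 : (0 : ℤ) ≤ ⌈(j : ℝ) / 2⌉ := Int.ceil_nonneg (by positivity)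
    calc (2 : ℝ) = 2 ^ (1 : ℤ) := by norm_num
      _ ≤ _ := zpow_le_zpow_right₀ (by norm_num) (by linarith)
  have haj0 : 0 < aj := lt_of_lt_of_le (by positivity) hajpos
  have hajpi : 1 ≤ aj * (π / 2) := by
    have := mul_le_mul_of_nonneg_right hajpos (by positivity : 0 ≤ π / 2)
    have e : 2 / π * (π / 2) = 1 := by field_simp
    linarith
  have hV0 : ∀ y : ℝ, 1 ≤ aj * |y| → V (aj * y) = 0 := by
    intro y hy
    by_contra hne
    have := hVsupp (Function.mem_support.mpr hne)
    have h2 : |aj * y| < 1 := abs_lt.mpr this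
    rw [abs_mul, abs_of_pos haj0] at h2
    linarith
  obtain ⟨hβ1, hβ2⟩ := abs_le.mp hω
  have hF : ∀ r : ℝ, r ≠ 0 → fourier2 ψ₀ (r * Real.cos β, r * Real.sin β) = 0 := by
    intro r hr
    rcases lt_or_gt_of_ne hr with hneg | hpos
    · rcases le_or_gt β 0 with hb | hb
      · have h := hψ₀ (-r) (by linarith) (β + π) ⟨by linarith, by linarith⟩
        rw [hV0 (β + π) (hajpi.trans (by
          gcongr; rw [abs_of_nonneg (by linarith)]; linarith))] at h
        simpa [Real.cos_add_pi, Real.sin_add_pi] using h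
      · have h := hψ₀ (-r) (by linarith) (β - π) ⟨by linarith, by linarith⟩
        rw [hV0 (β - π) (hajpi.trans (by
          gcongr; rw [abs_of_nonpos (by linarith)]; linarith))] at h
        simpa [Real.cos_sub_pi, Real.sin_sub_pi] using h
    · have h := hψ₀ r hpos β ⟨by linarith, by linarith⟩
      rw [hV0 β hinv] at h
      simpa using h
  have hS := slice_vanish ψ₀ β hF (s - (b.1 * Real.cos ω + b.2 * Real.sin ω))
  rw [← integral_sub_right_eq_self _ (-b.1 * Real.sin ω + b.2 * Real.cos ω)] at hS
  rw [← hS]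
  congr 1
  funext t
  rw [hψ]
  congr 1
  have hsc := Real.sin_sq_add_cos_sq ω
  simp only [rot, hβ, Real.cos_neg, Real.sin_neg, Real.cos_add, Real.sin_add, Prod.fst_sub,
    Prod.snd_sub]
  ext
  · simp only
    linear_combination (b.1 * Real.cos α - b.2 * Real.sin α) * hsc
  · simp only
    linear_combination (b.1 * Real.sin α + b.2 * Real.cos α) * hsc
end

section
/- Let H be a real Hilbert space, N ∈ ℕ, K : ℝ^N → H a continuous linear map, y ∈ H, and w ∈ ℝ^N with w_n > 0 for all n. Suppose for some index n₀ the n₀-th column of K is zero, i.e. K e_{n₀} = 0 where e_{n₀} is the n₀-th standard basis vector, and suppose y lies in the range of K. Then every minimizer ĉ ∈ ℝ^N of Ψ(c) = ½‖Kc − y‖²_H + Σ_{n=1}^N w_n |c_n| satisfies ĉ_{n₀} = 0. (This is the abstract core of the paper's theorem that invisible curvelet coefficients of the curvelet sparse regularized solution vanish.) -/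
open MeasureTheory

/-- Abstract core of the vanishing of invisible coefficients: if the `n₀`-th column
of `K` is zero and `y` lies in the range of `K`, then every minimizer of the
`ℓ¹`-penalized Tikhonov functional `c ↦ ½‖Kc - y‖² + Σ wₙ|cₙ|` has vanishing
`n₀`-th coefficient. -/
theorem minimizer_coeff_zero_of_zero_column
    {H : Type*} [NormedAddCommGroup H] [InnerProductSpace ℝ H] [CompleteSpace H]
    (N : ℕ) (K : EuclideanSpace ℝ (Fin N) →L[ℝ] H) (y : H)
    (w : Fin N → ℝ) (hw : ∀ n, 0 < w n)
    (n₀ : Fin N) (hcol : K (EuclideanSpace.single n₀ 1) = 0)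
    (hy : y ∈ Set.range K)
    (chat : EuclideanSpace ℝ (Fin N))
    (hmin : ∀ c : EuclideanSpace ℝ (Fin N),
      (1/2) * ‖K chat - y‖ ^ 2 + ∑ n, w n * |chat n|
        ≤ (1/2) * ‖K c - y‖ ^ 2 + ∑ n, w n * |c n|) :
    chat n₀ = 0 := by
  by_contra hne
  have h := hmin (chat - chat n₀ • EuclideanSpace.single n₀ (1 : ℝ))
  rw [map_sub, map_smul, hcol, smul_zero, sub_zero] at h
  have hlt : ∑ n, w n * |(chat - chat n₀ • EuclideanSpace.single n₀ (1 : ℝ)) n|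
      < ∑ n, w n * |chat n| := by
    apply Finset.sum_lt_sum
    · intro n _
      by_cases hn : n = n₀
      · subst hn
        simpa using mul_nonneg (hw n).le (abs_nonneg (chat n))
      · simp [hn]
    · refine ⟨n₀, Finset.mem_univ _, ?_⟩
      simpa using mul_pos (hw n₀) (abs_pos.mpr hne)
  linarith
end

section
/- Let H be a real Hilbert space, N ∈ ℕ, K : ℝ^N → H a continuous linear map with adjoint K*, y ∈ H, and w ∈ ℝ^N with w_k ≥ w₀ > 0 for all k for some w₀ > 0. Let Ψ(c) = ½‖Kc − y‖²_H + Σ_k w_k |c_k|. Then for every γ > 0 and every ĉ ∈ ℝ^N: ĉ is a minimizer of Ψ if and only if ĉ = S_{γw}(ĉ − γ K*(Kĉ − y)), where S_{γw} is the soft-thresholding operator with weight vector γw. -/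
/-- The soft-thresholding operator with weight vector `w`. -/
noncomputable def softThreshold {N : ℕ} (w : Fin N → ℝ) (x : Fin N → ℝ) : Fin N → ℝ :=
  fun k => max 0 (|x k| - w k) * Real.sign (x k)

theorem soft_aux {c g γ w : ℝ} (hγ : 0 < γ) (hw : 0 < w) :
    (∀ t, w * |c| ≤ w * |t| + g * (t - c)) ↔
      c = max 0 (|c - γ * g| - γ * w) * Real.sign (c - γ * g) := by
  constructor
  · intro h
    rcases lt_trichotomy c 0 with hc | hc | hc
    · have h0 := h 0
      have h2 := h (2 * c)
      rw [abs_mul, abs_of_neg hc] at h2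
      rw [abs_of_neg hc] at h0
      norm_num at h0 h2
      have hg : g = w := by nlinarith
      subst hg
      have hx : c - γ * g < 0 := by nlinarith
      rw [Real.sign_of_neg hx, abs_of_neg hx, max_eq_right (by linarith)]
      ring
    · subst hc
      have h1 := h 1
      have h2 := h (-1)
      norm_num at h1 h2
      have hg : |g| ≤ w := abs_le.mpr ⟨by linarith, by linarith⟩
      rw [max_eq_left, zero_mul]
      rw [zero_sub, abs_neg, abs_mul, abs_of_pos hγ]
      nlinarith
    · have h0 := h 0
      have h2 := h (2 * c)
      rw [abs_mul, abs_of_pos hc] at h2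
      rw [abs_of_pos hc] at h0
      norm_num at h0 h2
      have hg : g = -w := by nlinarith
      subst hg
      have hx : 0 < c - γ * -w := by nlinarith
      rw [Real.sign_of_pos hx, abs_of_pos hx, max_eq_right (by linarith)]
      ring
  · intro h
    have key : |g| ≤ w ∧ w * |c| = - (g * c) := by
      have hγw : 0 < γ * w := mul_pos hγ hw
      rcases le_total (|c - γ * g| - γ * w) 0 with hm | hm
      · rw [max_eq_left hm, zero_mul] at h
        subst h
        rw [zero_sub, abs_neg, abs_mul, abs_of_pos hγ] at hm
        exact ⟨by nlinarith, by simp⟩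
      · rw [max_eq_right hm] at h
        rcases lt_trichotomy (c - γ * g) 0 with hx | hx | hx
        · rw [Real.sign_of_neg hx, abs_of_neg hx] at h
          rw [abs_of_neg hx] at hm
          have hg : g = w := by
            apply mul_left_cancel₀ hγ.ne'
            linarith
          subst hg
          have : c ≤ 0 := by linarith
          rw [abs_of_pos hw, abs_of_nonpos this]
          exact ⟨le_rfl, by ring⟩
        · rw [hx, abs_zero] at hm
          linarith
        · rw [Real.sign_of_pos hx, abs_of_pos hx] at h
          rw [abs_of_pos hx] at hm
          have hg : g = -w := by
            apply mul_left_cancel₀ hγ.ne'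
            linarith
          subst hg
          have : 0 ≤ c := by linarith
          rw [abs_neg, abs_of_pos hw, abs_of_nonneg this]
          exact ⟨le_rfl, by ring⟩
    intro t
    have h1 : |g * t| ≤ w * |t| := by
      rw [abs_mul]
      exact mul_le_mul_of_nonneg_right key.1 (abs_nonneg t)
    have h2 := neg_abs_le (g * t)
    rw [key.2]
    linarith

/-- A point `chat` is a minimizer of the `ℓ¹`-penalized Tikhonov functional
`Ψ(c) = ½‖Kc - y‖² + Σ wₖ|cₖ|` if and only if it is a fixed point of
`c ↦ S_{γw}(c - γ K*(Kc - y))`, for any `γ > 0`. -/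
theorem minimizer_iff_fixed_point_of_soft_thresholding
    {H : Type*} [NormedAddCommGroup H] [InnerProductSpace ℝ H] [CompleteSpace H]
    (N : ℕ) (K : EuclideanSpace ℝ (Fin N) →L[ℝ] H) (y : H)
    (w : Fin N → ℝ) (w₀ : ℝ) (hw₀ : 0 < w₀) (hw : ∀ k, w₀ ≤ w k)
    (Ψ : EuclideanSpace ℝ (Fin N) → ℝ)
    (hΨ : ∀ c, Ψ c = (1/2) * ‖K c - y‖ ^ 2 + ∑ k, w k * |c k|)
    (γ : ℝ) (hγ : 0 < γ) (chat : EuclideanSpace ℝ (Fin N)) :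
    (∀ c, Ψ chat ≤ Ψ c) ↔
      ∀ k, chat k
        = softThreshold (γ • w)
            (chat - γ • (ContinuousLinearMap.adjoint K) (K chat - y)) k := by
  set g := (ContinuousLinearMap.adjoint K) (K chat - y) with hg
  have expand : ∀ d, Ψ (chat + d) - Ψ chat = ∑ k, g k * d k + (1/2) * ‖K d‖ ^ 2
      + ∑ k, w k * (|chat k + d k| - |chat k|) := by
    intro d
    have h1 : inner ℝ (K chat - y) (K d) = ∑ k, g k * d k := by
      rw [← ContinuousLinearMap.adjoint_inner_left, ← hg, PiLp.inner_apply]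
      apply Finset.sum_congr rfl
      intro k _
      simp [mul_comm]
    have h2 : K (chat + d) - y = (K chat - y) + K d := by
      rw [map_add]; abel
    rw [hΨ, hΨ, h2, norm_add_sq_real, h1]
    simp only [mul_sub, Finset.sum_sub_distrib, PiLp.add_apply]
    ring
  have main : (∀ c, Ψ chat ≤ Ψ c) ↔
      ∀ k, ∀ t, w k * |chat k| ≤ w k * |t| + g k * (t - chat k) := by
    constructor
    · intro h k t
      have hwk : 0 < w k := lt_of_lt_of_le hw₀ (hw k)
      set B := g k * (t - chat k) + w k * (|t| - |chat k|) with hB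
      set e : EuclideanSpace ℝ (Fin N) := EuclideanSpace.single k (t - chat k) with he
      set A := (1/2) * ‖K e‖ ^ 2 with hA
      have hA0 : 0 ≤ A := by positivity
      have hs : ∀ s : ℝ, 0 < s → s ≤ 1 → 0 ≤ B + s * A := by
        intro s hs0 hs1
        have h1 := expand (s • e)
        have h2 := h (chat + s • e)
        have h3 : ∑ j, g j * (s • e) j = s * (g k * (t - chat k)) := by
          rw [Finset.sum_eq_single k]
          · simp [he]; ring
          · intro j _ hj
            simp [he, hj]
          · simp
        have h4 : ∑ j, w j * (|chat j + (s • e) j| - |chat j|)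
            = w k * (|chat k + s * (t - chat k)| - |chat k|) := by
          rw [Finset.sum_eq_single k]
          · simp [he]
          · intro j _ hj
            simp [he, hj]
          · simp
        have h5 : (1/2) * ‖K (s • e)‖ ^ 2 = s ^ 2 * A := by
          rw [map_smul, norm_smul, Real.norm_eq_abs, mul_pow, sq_abs, hA]; ring
        have h6 : |chat k + s * (t - chat k)| ≤ (1 - s) * |chat k| + s * |t| := by
          have : chat k + s * (t - chat k) = (1 - s) * chat k + s * t := by ring
          rw [this]
          refine (abs_add_le _ _).trans ?_
          rw [abs_mul, abs_mul, abs_of_pos hs0, abs_of_nonneg (by linarith : 0 ≤ 1 - s)]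
        rw [h3, h4, h5] at h1
        have h7 := mul_le_mul_of_nonneg_left h6 hwk.le
        have h8 : 0 ≤ s * (B + s * A) := by
          rw [hB]; nlinarith
        exact nonneg_of_mul_nonneg_right h8 hs0
      have hB0 : 0 ≤ B := by
        by_contra hneg
        push Not at hneg
        have hd : 0 < A - B := by linarith
        have h9 := hs (-B / (2 * (A - B))) (by apply div_pos <;> linarith)
          (by rw [div_le_one (by linarith)]; linarith)
        have h10 : -B / (2 * (A - B)) * A ≤ -B / 2 := by
          rw [div_mul_eq_mul_div, div_le_div_iff₀ (by linarith) (by norm_num)]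
          nlinarith
        linarith
      rw [hB] at hB0
      linarith
    · intro h c
      have h1 := expand (c - chat)
      rw [add_sub_cancel] at h1
      have h2 : 0 ≤ ∑ k, (g k * (c - chat) k + w k * (|chat k + (c - chat) k| - |chat k|)) := by
        apply Finset.sum_nonneg
        intro k _
        have := h k (c k)
        rw [PiLp.sub_apply, add_sub_cancel]
        linarith
      rw [Finset.sum_add_distrib] at h2
      have h3 : 0 ≤ (1/2) * ‖K (c - chat)‖ ^ 2 := by positivity
      linarith
  rw [main]
  refine forall_congr' fun k => ?_
  rw [soft_aux hγ (lt_of_lt_of_le hw₀ (hw k))]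
  simp [softThreshold]
end

section
/- Let φ : ℝ → ℝ be a Schwartz function. Then lim_{b → ∞} ∫_ℝ (1/π) · (sin(b x)/x) · φ(x) dx = φ(0); that is, the functions δ^b(x) = (2π)^{-1} ∫_{−b}^{b} e^{i x ξ} dξ = sin(bx)/(πx) converge to the Dirac delta distribution when tested against Schwartz functions, as b → ∞. -/
open Real Filter

open scoped FourierTransform in
open MeasureTheory in
lemma dirichlet_fubini (f : SchwartzMap ℝ ℂ) (c : ℝ) (hc : 0 ≤ c) :
    ∫ ξ in (-c)..c, 𝓕 (f : ℝ → ℂ) ξ =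
      ∫ x : ℝ, ((1 / π * (Real.sin (2 * π * c * x) / x) : ℝ) : ℂ) * f x := by
  have hcc : -c ≤ c := by linarith
  simp_rw [Real.fourier_real_eq_integral_exp_smul]
  rw [intervalIntegral.integral_of_le hcc, integral_integral_swap]
  · apply integral_congr_ae
    have h0 : ∀ᵐ x : ℝ, x ≠ 0 := by
      simp [ae_iff]
    filter_upwards [h0] with x hx
    rw [← intervalIntegral.integral_of_le hcc]
    simp only [smul_eq_mul]
    rw [intervalIntegral.integral_mul_const]
    congr 1
    have hx' : (x : ℂ) ≠ 0 := by exact_mod_cast hx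
    have hpi : (π : ℂ) ≠ 0 := by exact_mod_cast Real.pi_ne_zero
    have ha : (-2 * π * x * Complex.I : ℂ) ≠ 0 := by simp [hx, Real.pi_ne_zero]
    have := integral_exp_mul_complex (a := -c) (b := c) ha
    rw [show (fun ξ : ℝ => Complex.exp (↑(-2 * π * x * ξ) * Complex.I)) =
      fun ξ : ℝ => Complex.exp ((-2 * π * x * Complex.I) * ξ) by
        ext ξ; congr 1; push_cast; ring, this]
    push_cast
    rw [Complex.sin]
    rw [show (-2 * π * x * Complex.I * c : ℂ) = -(2 * π * c * x) * Complex.I by ring,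
      show (-2 * π * x * Complex.I * -c : ℂ) = (2 * π * c * x) * Complex.I by ring]
    field_simp
    rw [Complex.I_sq]
    ring
  · have h1 : Integrable (fun p : ℝ × ℝ => (1 : ℂ) * f p.2)
        ((volume.restrict (Set.Ioc (-c) c)).prod volume) :=
      Integrable.mul_prod (integrable_const (1 : ℂ)) f.integrable
    refine h1.mono ?_ (Eventually.of_forall fun p => ?_)
    · refine Continuous.aestronglyMeasurable ?_
      have := f.continuous
      simp only [Function.uncurry_def]
      fun_prop
    · simp only [Function.uncurry_def, norm_smul, Complex.norm_exp_ofReal_mul_I, norm_mul,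
        norm_one, le_refl]

/-- Dirac delta approximation: for a Schwartz function `φ`,
`∫ (1/π) (sin(bx)/x) φ(x) dx → φ(0)` as `b → ∞`. -/
theorem delta_approximation (φ : SchwartzMap ℝ ℝ) :
    Tendsto (fun b : ℝ => ∫ x : ℝ, (1 / π) * (Real.sin (b * x) / x) * φ x)
      atTop (nhds (φ 0)) := by
  open scoped FourierTransform in
  let f : SchwartzMap ℝ ℂ := φ.postcompCLM Complex.ofRealCLM
  have hf : ∀ x, f x = (φ x : ℂ) := fun x => rfl
  have hint : ∫ ξ, (𝓕 f) ξ = (φ 0 : ℂ) := by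
    have h : (𝓕⁻ (𝓕 f)) 0 = f 0 := by rw [FourierTransform.fourierInv_fourier_eq]
    rw [SchwartzMap.fourierInv_coe, Real.fourierInv_eq] at h
    simpa [hf] using h
  have hb : Tendsto (fun b : ℝ => b / (2 * π)) atTop atTop :=
    tendsto_id.atTop_div_const (by positivity)
  have hlim := MeasureTheory.intervalIntegral_tendsto_integral (𝓕 f).integrable
    (tendsto_neg_atTop_atBot.comp hb) hb (μ := MeasureTheory.volume)
  rw [hint] at hlim
  have hre := (Complex.continuous_re.tendsto _).comp hlim
  simp only [Complex.ofReal_re] at hre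
  refine hre.congr' ?_
  filter_upwards [eventually_ge_atTop 0] with b hb0
  have := dirichlet_fubini f (b / (2 * π)) (by positivity)
  simp only [Function.comp_apply, SchwartzMap.fourier_coe]
  rw [this, show 2 * π * (b / (2 * π)) = b by field_simp]
  simp_rw [hf, ← Complex.ofReal_mul]
  rw [integral_complex_ofReal, Complex.ofReal_re]
end

section
/- Let f : ℝ² → ℂ be a Schwartz function and η ∈ ℝ. With ξ = (cos η, sin η) and ξ^⊥ = (−sin η, cos η), it holds that ∫_ℝ f(t ξ) dt = ∫_ℝ f̂(t ξ^⊥) dt; that is, integration of f in the spatial domain along a line through the origin equals integration of f̂ along the perpendicular line through the origin in the frequency domain. -/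
open MeasureTheory Real

open scoped FourierTransform

/-- `f` pulled back to `ℂ` by the rotation of angle `η`, as a linear equivalence. -/
noncomputable def rotEquivAux (η : ℝ) : ℂ ≃L[ℝ] ℝ × ℝ :=
  (rotation (Circle.exp η)).toContinuousLinearEquiv.trans Complex.equivRealProdCLM

lemma rotEquivAux_apply (η : ℝ) (z : ℂ) :
    rotEquivAux η z = (z.re * cos η - z.im * sin η, z.re * sin η + z.im * cos η) := by
  have h : rotEquivAux η z = ((Complex.exp (η * Complex.I) * z).re,
      (Complex.exp (η * Complex.I) * z).im) := by
    simp [rotEquivAux, rotation_apply, Circle.coe_exp]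
  rw [h]
  simp only [Complex.mul_re, Complex.mul_im, Complex.exp_ofReal_mul_I_re,
    Complex.exp_ofReal_mul_I_im]
  ext <;> simp <;> ring

lemma rotEquivAux_mp (η : ℝ) : MeasurePreserving (rotEquivAux η) volume volume := by
  have h1 : MeasurePreserving (rotation (Circle.exp η)) volume volume :=
    (rotation (Circle.exp η)).measurePreserving
  exact Complex.volume_preserving_equiv_real_prod.comp h1

noncomputable def pullAux (f : SchwartzMap (ℝ × ℝ) ℂ) (η : ℝ) : SchwartzMap ℂ ℂ :=
  SchwartzMap.compCLMOfContinuousLinearEquiv ℂ (rotEquivAux η) f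

lemma pullAux_apply (f : SchwartzMap (ℝ × ℝ) ℂ) (η : ℝ) (z : ℂ) :
    pullAux f η z = f (rotEquivAux η z) := rfl

/-- the projection of a Schwartz function onto the vertical axis -/
noncomputable def projAux (G : SchwartzMap ℂ ℂ) (u : ℝ) : ℂ := ∫ s : ℝ, G ⟨s, u⟩

lemma integrable_pairAux (G : SchwartzMap ℂ ℂ) :
    Integrable (fun p : ℝ × ℝ => G ⟨p.1, p.2⟩) (volume.prod volume) := by
  have h := Complex.volume_preserving_equiv_real_prod.symm
  exact (h.integrable_comp_emb (MeasurableEquiv.measurableEmbedding _)).2 G.integrable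

lemma projAux_integrable (G : SchwartzMap ℂ ℂ) : Integrable (projAux G) :=
  (integrable_pairAux G).integral_prod_right

lemma projAux_continuous (G : SchwartzMap ℂ ℂ) : Continuous (projAux G) := by
  have hc : Continuous fun p : ℝ × ℝ => G ⟨p.1, p.2⟩ :=
    G.continuous.comp Complex.equivRealProdCLM.symm.continuous
  have hb := fun z => SchwartzMap.one_add_le_sup_seminorm_apply (𝕜 := ℂ) (m := (2, 0)) (k := 2)
    (n := 0) le_rfl le_rfl G z
  set C := 2 ^ 2 * ((Finset.Iic ((2, 0) : ℕ × ℕ)).sup fun m => SchwartzMap.seminorm ℂ m.1 m.2) G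
  refine continuous_of_dominated (bound := fun s : ℝ => C * (1 + ‖s‖) ^ (-(2 : ℝ))) ?_ ?_ ?_ ?_
  · intro u
    exact (hc.comp (by fun_prop : Continuous fun s : ℝ => (s, u))).aestronglyMeasurable
  · intro u
    refine Filter.Eventually.of_forall fun s => ?_
    have h := hb ⟨s, u⟩
    rw [norm_iteratedFDeriv_zero] at h
    have hs : ‖s‖ ≤ ‖(⟨s, u⟩ : ℂ)‖ := Complex.abs_re_le_norm ⟨s, u⟩
    have hp : 0 < 1 + ‖s‖ := by positivity
    rw [Real.rpow_neg hp.le, ← div_eq_mul_inv, le_div_iff₀ (by positivity), mul_comm]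
    refine le_trans ?_ h
    rw [Real.rpow_two]
    gcongr
  · exact (integrable_one_add_norm (by simp)).const_mul C
  · exact Filter.Eventually.of_forall fun s =>
      hc.comp (by fun_prop : Continuous fun u : ℝ => (s, u))

lemma fourier_projAux (G : SchwartzMap ℂ ℂ) (w : ℝ) :
    𝓕 (projAux G) w = 𝓕 (G : ℂ → ℂ) ⟨0, w⟩ := by
  rw [Real.fourier_eq', Real.fourier_eq']
  have h := Complex.volume_preserving_equiv_real_prod.symm
  rw [← h.integral_comp (MeasurableEquiv.measurableEmbedding _)]
  have e : ∀ p : ℝ × ℝ, Complex.measurableEquivRealProd.symm p = ⟨p.1, p.2⟩ := fun p => rfl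
  simp only [e]
  rw [Measure.volume_eq_prod, integral_prod_symm]
  · refine integral_congr_ae (Filter.Eventually.of_forall fun u => ?_)
    simp only [projAux, smul_eq_mul]
    rw [← integral_const_mul]
    simp [Complex.inner]
  · refine (integrable_pairAux G).bdd_mul (c := 1) ?_ ?_
    · apply Continuous.aestronglyMeasurable
      simp only [Complex.inner, Complex.mul_re, Complex.conj_re, Complex.conj_im]
      fun_prop
    · refine Filter.Eventually.of_forall fun p => ?_
      rw [Complex.norm_exp_ofReal_mul_I]

lemma fourier_line_integrable (G : SchwartzMap ℂ ℂ) :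
    Integrable fun w : ℝ => 𝓕 (G : ℂ → ℂ) ⟨0, w⟩ := by
  rw [← SchwartzMap.fourier_coe]
  let L : ℝ →L[ℝ] ℂ := (ContinuousLinearMap.id ℝ ℝ).smulRight Complex.I
  have hL : ∀ w, L w = ⟨0, w⟩ := fun w => by
    apply Complex.ext <;> simp [L]
  have hA : AntilipschitzWith 1 L := by
    refine AddMonoidHomClass.antilipschitz_of_bound L fun x => ?_
    simp [L]
  have := (SchwartzMap.compCLMOfAntilipschitz ℂ L.hasTemperateGrowth hA (𝓕 G)).integrable
    (μ := volume)
  refine this.congr (Filter.Eventually.of_forall fun w => ?_)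
  simp [hL]

lemma fourier2_eqAux (f : SchwartzMap (ℝ × ℝ) ℂ) (η t : ℝ) :
    fourier2 (⇑f) (-t * Real.sin η, t * Real.cos η)
      = ((2 * π : ℝ)⁻¹ : ℝ) * 𝓕 (pullAux f η : ℂ → ℂ) ⟨0, (2 * π)⁻¹ * t⟩ := by
  rw [fourier2, Real.fourier_eq',
    ← (rotEquivAux_mp η).integral_comp (rotEquivAux η).toHomeomorph.measurableEmbedding]
  push_cast
  congr 1
  refine integral_congr_ae (Filter.Eventually.of_forall fun z => ?_)
  simp only [smul_eq_mul, pullAux_apply]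
  rw [mul_comm]
  congr 2
  rw [rotEquivAux_apply]
  have h1 : Complex.cos η ^ 2 = 1 - Complex.sin η ^ 2 := Complex.cos_sq' _
  have hpi : (π : ℂ) ≠ 0 := by exact_mod_cast Real.pi_ne_zero
  simp only [Complex.inner, Complex.mul_re, Complex.conj_re, Complex.conj_im]
  push_cast
  field_simp
  ring_nf
  rw [h1]
  ring

/-- Integration of a Schwartz function along a line through the origin equals
integration of its Fourier transform along the perpendicular line through the
origin. -/
theorem integral_line_eq_integral_fourier_perp_line
    (f : SchwartzMap (ℝ × ℝ) ℂ) (η : ℝ) :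
    ∫ t : ℝ, f (t * Real.cos η, t * Real.sin η)
      = ∫ t : ℝ, fourier2 (⇑f) (-t * Real.sin η, t * Real.cos η) := by
  set G := pullAux f η with hG
  have hF : Integrable (𝓕 (projAux G)) := by
    have := fourier_line_integrable G
    simpa only [← fourier_projAux] using this
  have inv := congrFun ((projAux_continuous G).fourierInv_fourier_eq (projAux_integrable G) hF) 0
  rw [Real.fourierInv_eq'] at inv
  simp only [inner_zero_right, mul_zero, Complex.ofReal_zero, zero_mul, Complex.exp_zero,
    one_smul] at inv
  have hpi : (0 : ℝ) < 2 * π := by positivity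
  have h0 : projAux G 0 = ∫ t : ℝ, f (t * Real.cos η, t * Real.sin η) := by
    simp only [projAux, hG, pullAux_apply, rotEquivAux_apply]
    simp
  rw [← h0, ← inv]
  simp only [fourier2_eqAux, ← hG, ← fourier_projAux]
  rw [integral_const_mul, Measure.integral_comp_mul_left (fun w => 𝓕 (projAux G) w), inv_inv,
    abs_of_pos hpi, Complex.real_smul, ← mul_assoc, ← Complex.ofReal_mul,
    inv_mul_cancel₀ hpi.ne']
  simp
end

section
/- Let ι be a countable type, and let φ : ℝ → ℝ be a convex function with φ(0) = 0 and φ(t) ≥ 0 for all t. Let x, y ∈ ℓ²(ι, ℝ) and assume the family (φ(x_n))_{n ∈ ι} is summable. Then the following are equivalent: (i) for every z ∈ ℓ²(ι, ℝ) such that (φ(z_n))_{n ∈ ι} is summable, one has Σ_n φ(z_n) ≥ Σ_n φ(x_n) + ⟨y, z − x⟩ (i.e. y is a subgradient at x of the separable functional f(x) = Σ_n φ(x_n)); (ii) for every n ∈ ι and every t ∈ ℝ, φ(t) ≥ φ(x_n) + y_n · (t − x_n) (i.e. y_n is a subgradient of φ at x_n for every n). -/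
open scoped RealInnerProductSpace

/-- Subdifferential of a separable convex functional on `ℓ²(ι, ℝ)`: `y` is a
subgradient of `f(x) = Σₙ φ(xₙ)` at `x` (in the sense of the subgradient
inequality against all `z` with summable `φ(zₙ)`) if and only if `yₙ` is a
subgradient of `φ` at `xₙ` for every `n`. -/
theorem subgradient_separable_iff_componentwise
    {ι : Type*} [Countable ι]
    (φ : ℝ → ℝ) (hconv : ConvexOn ℝ Set.univ φ)
    (hφ0 : φ 0 = 0) (hφnn : ∀ t, 0 ≤ φ t)
    (x y : lp (fun _ : ι => ℝ) 2)
    (hx : Summable fun n => φ (x n)) :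
    ((∀ z : lp (fun _ : ι => ℝ) 2, Summable (fun n => φ (z n)) →
        (∑' n, φ (x n)) + ⟪y, z - x⟫ ≤ ∑' n, φ (z n)) ↔
      ∀ (n : ι) (t : ℝ), φ (x n) + y n * (t - x n) ≤ φ t) := by
  classical
  constructor
  · intro h n t
    have hs : HasSum (fun m => φ ((x + lp.single 2 n (t - x n) : lp (fun _ : ι => ℝ) 2) m))
        ((∑' m, φ (x m)) + (φ t - φ (x n))) := by
      have h1 := hx.hasSum.add (hasSum_ite_eq n (φ t - φ (x n)))
      refine h1.congr_fun ?_
      intro m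
      by_cases hm : m = n
      · subst hm
        simp
      · simp [hm]
    have h2 := h _ hs.summable
    rw [hs.tsum_eq, add_sub_cancel_left, lp.inner_single_right] at h2
    have h3 : ⟪y n, t - x n⟫ = y n * (t - x n) := by
      simp [mul_comm]
    rw [h3] at h2
    linarith
  · intro h z hz
    have h1 := hx.hasSum.add (lp.hasSum_inner (𝕜 := ℝ) y (z - x))
    refine hasSum_le ?_ h1 hz.hasSum
    intro n
    have h3 : ⟪y n, (z - x) n⟫ = y n * (z n - x n) := by
      simp [mul_comm]
    rw [h3]
    exact h n (z n)
end
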